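/- Let R and S be rows of shapes k ≥ h with R ⟵ S, aligned to the left. If the tableau (R,S) is not weakly-standard-compatible as a two-row tableau of adapted shape (k,h) with k > h, i.e., there is an index of violation t, then applying shuffling relations repeatedly terminates: each shuffling relation for a non-standard two-row tableau with index of violation t expresses it as a linear combination of two-row tableaux each of which is either standard or has index of violation strictly greater than t; since the index of violation is bounded by the row length, finitely many applications yield a straightening relation. -/

import Mathlib

namespace Rows

/-- A row of shape `k` for the parameter `ℓ`: a strictly increasing list of
integers in `{1, …, ℓ+1}` (its shape is its length). -/
def IsRow (ℓ : ℕ) (R : List ℕ) : Prop :=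
  R.Chain' (· < ·) ∧ ∀ x ∈ R, 1 ≤ x ∧ x ≤ ℓ + 1

/-- The relation `⟵` on rows: align the rows to the left if the first has shape
greater than or equal to that of the second, and to the right otherwise, and
require the entries in each common column to be non-decreasing. -/
def rowRel (R S : List ℕ) : Prop :=
  if S.length ≤ R.length then ∀ t < S.length, R.getD t 0 ≤ S.getD t 0
  else ∀ t < R.length, R.getD t 0 ≤ S.getD (S.length - R.length + t) 0

/-- The characterization of the swap maps `φ_{k,h}(R,S) = (R⁰,S⁰)` on a
comparable pair `R ⟵ S` of rows of shapes `k, h`.  For `k ≤ h`: `S⁰` is the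
`⟵`-minimal shape-`k` subrow of `S` with `R ⟵ S⁰` and `R⁰` is the `⟵`-maximal
shape-`h` row containing `R` with `R⁰ ⟵ S`; for `k ≥ h` the definitions are
dual. -/
def SwapSpec (ℓ : ℕ) (R S Rn Sn : List ℕ) : Prop :=
  if R.length ≤ S.length then
    (Sn.Sublist S ∧ Sn.length = R.length ∧ rowRel R Sn ∧
      ∀ S', S'.Sublist S → S'.length = R.length → rowRel R S' → rowRel Sn S') ∧
    (R.Sublist Rn ∧ Rn.length = S.length ∧ IsRow ℓ Rn ∧ rowRel Rn S ∧
      ∀ R', R.Sublist R' → R'.length = S.length → IsRow ℓ R' → rowRel R' S → rowRel R' Rn)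
  else
    (Rn.Sublist R ∧ Rn.length = S.length ∧ rowRel Rn S ∧
      ∀ R', R'.Sublist R → R'.length = S.length → rowRel R' S → rowRel R' Rn) ∧
    (S.Sublist Sn ∧ Sn.length = R.length ∧ IsRow ℓ Sn ∧ rowRel R Sn ∧
      ∀ S', S.Sublist S' → S'.length = R.length → IsRow ℓ S' → rowRel R S' → rowRel Sn S')

/-- A tableau (a list of rows) is weakly standard if each row is `⟵`-less than
or equal to the next one. -/
def WeaklyStdTab (T : List (List ℕ)) : Prop := T.Chain' rowRel

/-- One application of a swap map to an adjacent comparable pair of rows of a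
tableau. -/
def TabStep (ℓ : ℕ) (T T' : List (List ℕ)) : Prop :=
  ∃ p q R S Rn Sn, rowRel R S ∧ SwapSpec ℓ R S Rn Sn ∧
    T = p ++ R :: S :: q ∧ T' = p ++ Rn :: Sn :: q

/-- A tableau is standard if all tableaux obtained from it by repeatedly
applying swap maps to adjacent comparable pairs of rows are weakly standard. -/
def StdTab (ℓ : ℕ) (T : List (List ℕ)) : Prop :=
  ∀ T', Relation.ReflTransGen (TabStep ℓ) T T' → WeaklyStdTab T'

end Rows

open Rows

/-- The Plücker coordinates, realized as minors of a generic matrix. -/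
noncomputable def pluck (R : List ℕ) : MvPolynomial (ℕ × ℕ) ℂ :=
  Matrix.det (Matrix.of fun i j : Fin R.length => MvPolynomial.X (R.get i, (j : ℕ)))

/-- `t` is the index of violation of standardness of the left-aligned two-row
tableau `(R,S)` (with the shape of `R` at least that of `S`): the first `t`
columns are non-decreasing, while column `t` decreases. -/
def ViolIdx (R S : List ℕ) (t : ℕ) : Prop :=
  t < S.length ∧ S.getD t 0 < R.getD t 0 ∧ ∀ t' < t, R.getD t' 0 ≤ S.getD t' 0

/-- The minor on the rows `f` and the first `n` columns of the generic matrix. -/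
noncomputable def minor {n : ℕ} (f : Fin n → ℕ) : MvPolynomial (ℕ × ℕ) ℂ :=
  Matrix.det (Matrix.of fun i j : Fin n => MvPolynomial.X (f i, (j : ℕ)))

theorem pluck_ofFn {n : ℕ} (f : Fin n → ℕ) : pluck (List.ofFn f) = minor f := by
  rw [minor, ← Matrix.det_submatrix_equiv_self (finCongr (List.length_ofFn (f := f)))]
  unfold pluck
  congr 1
  ext i j : 2
  rw [Matrix.submatrix_apply, Matrix.of_apply, Matrix.of_apply, List.get_ofFn]
  rfl

theorem minor_comp_perm {n : ℕ} (f : Fin n → ℕ) (σ : Equiv.Perm (Fin n)) :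
    minor (f ∘ σ) = (Equiv.Perm.sign σ : ℤ) • minor f := by
  rw [zsmul_eq_mul]
  exact Matrix.det_permute σ (Matrix.of fun i j : Fin n => MvPolynomial.X (f i, (j : ℕ)))

theorem minor_eq_zero_of_not_injective {n : ℕ} {f : Fin n → ℕ}
    (hf : ¬ Function.Injective f) : minor f = 0 := by
  simp only [Function.Injective, not_forall] at hf
  obtain ⟨i, j, hij, hne⟩ := hf
  exact Matrix.det_zero_of_row_eq hne (by ext1 c; simp [hij])

theorem minor_eq_sum {n : ℕ} (f : Fin n → ℕ) :
    minor f = ∑ τ : Equiv.Perm (Fin n), (Equiv.Perm.sign τ : ℤ) •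
      ∏ i, (MvPolynomial.X (f i, (τ i : ℕ)) : MvPolynomial (ℕ × ℕ) ℂ) := by
  rw [minor, ← Matrix.det_transpose, Matrix.det_apply]
  rfl

section Shuffle

variable {k h : ℕ} (p : Fin k → Prop) (q : Fin h → Prop) [DecidablePred p] [DecidablePred q]
  (r : Fin k → ℕ) (s : Fin h → ℕ) (σ : Equiv.Perm ({i // p i} ⊕ {j // q j}))

/-- The entries of two rows at the places `p` and `q`. -/
def shuffleEntries : {i // p i} ⊕ {j // q j} → ℕ :=
  Sum.elim (fun i => r i) (fun j => s j)

/-- The first row after shuffling the entries at the places `p` and `q` by `σ`. -/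
def shuffleFst (i : Fin k) : ℕ :=
  if hi : p i then shuffleEntries p q r s (σ (Sum.inl ⟨i, hi⟩)) else r i

/-- The second row after shuffling the entries at the places `p` and `q` by `σ`. -/
def shuffleSnd (j : Fin h) : ℕ :=
  if hj : q j then shuffleEntries p q r s (σ (Sum.inr ⟨j, hj⟩)) else s j

@[to_additive]
theorem shuffle_prod_eq {M : Type*} [CommMonoid M] (F : Fin k → ℕ → M) (G : Fin h → ℕ → M) :
    (∏ i, F i (shuffleFst p q r s σ i)) * ∏ j, G j (shuffleSnd p q r s σ j) =
      (∏ x, Sum.elim (fun i : {i // p i} => F i) (fun j : {j // q j} => G j) x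
        (shuffleEntries p q r s (σ x))) *
      ((∏ i : {i // ¬ p i}, F i (r i)) * ∏ j : {j // ¬ q j}, G j (s j)) := by
  rw [← Fintype.prod_subtype_mul_prod_subtype p, ← Fintype.prod_subtype_mul_prod_subtype q,
    Fintype.prod_sum_type, mul_mul_mul_comm]
  congr 1 <;> congr 1 <;> refine Finset.prod_congr rfl fun x _ => ?_ <;>
    simp [shuffleFst, shuffleSnd, x.2]

theorem shuffle_content :
    (↑(List.ofFn (shuffleFst p q r s σ)) + ↑(List.ofFn (shuffleSnd p q r s σ)) : Multiset ℕ) =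
      ↑(List.ofFn r) + ↑(List.ofFn s) := by
  have key : ∀ {n : ℕ} (f : Fin n → ℕ), (↑(List.ofFn f) : Multiset ℕ) = ∑ i, {f i} := by
    intro n f
    rw [← List.sum_ofFn, ← Multiset.sum_map_singleton (List.ofFn f : Multiset ℕ),
      Multiset.map_coe, Multiset.sum_coe, List.map_ofFn]
    rfl
  have hσ := shuffle_sum_eq p q r s σ (fun _ x => ({x} : Multiset ℕ)) (fun _ x => {x})
  have h1 := shuffle_sum_eq p q r s 1 (fun _ x => ({x} : Multiset ℕ)) (fun _ x => {x})
  have e1 : shuffleFst p q r s 1 = r := by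
    ext i; by_cases hi : p i <;> simp [shuffleFst, shuffleEntries, hi]
  have e2 : shuffleSnd p q r s 1 = s := by
    ext i; by_cases hi : q i <;> simp [shuffleSnd, shuffleEntries, hi]
  have e3 : ∀ x, Sum.elim (fun (_ : {i // p i}) (y : ℕ) => ({y} : Multiset ℕ))
      (fun (_ : {j // q j}) y => {y}) x = fun y => {y} := by rintro (x | x) <;> rfl
  rw [e1, e2] at h1
  simp only [e3] at hσ h1
  rw [key, key, key, key, hσ, h1]
  congr 1
  exact Equiv.sum_comp σ fun x => ({shuffleEntries p q r s x} : Multiset ℕ)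

/-- The shuffling relation, summed over all permutations of the shuffled entries. -/
theorem shuffling_relation (hhk : h ≤ k)
    (hcard : k < Fintype.card ({i // p i} ⊕ {j // q j})) :
    ∑ σ : Equiv.Perm ({i // p i} ⊕ {j // q j}), (Equiv.Perm.sign σ : ℤ) •
      (minor (shuffleFst p q r s σ) * minor (shuffleSnd p q r s σ)) = 0 := by
  simp only [minor_eq_sum, Finset.sum_mul_sum, Finset.smul_sum, smul_mul_smul_comm]
  rw [Finset.sum_comm]
  refine Finset.sum_eq_zero fun τ _ => ?_
  rw [Finset.sum_comm]
  refine Finset.sum_eq_zero fun ρ _ => ?_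
  let g : {i // p i} ⊕ {j // q j} → Fin k :=
    Sum.elim (fun i => τ i) (fun j => Fin.castLE hhk (ρ j))
  obtain ⟨a, b, hab, hg⟩ := Fintype.exists_ne_map_eq_of_card_lt g (by simpa using hcard)
  have hdet : Matrix.det (Matrix.of fun x y : {i // p i} ⊕ {j // q j} =>
      (MvPolynomial.X (shuffleEntries p q r s x, (g y : ℕ)) : MvPolynomial (ℕ × ℕ) ℂ)) = 0 :=
    Matrix.det_zero_of_column_eq hab fun x => by simp [hg]
  rw [Matrix.det_apply] at hdet
  simp only [shuffle_prod_eq p q r s _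
    (fun i x => (MvPolynomial.X (x, (τ i : ℕ)) : MvPolynomial (ℕ × ℕ) ℂ))
    (fun j x => MvPolynomial.X (x, (ρ j : ℕ)))]
  simp only [smul_comm (_ : ℤ) ((_ : ℤ) * (_ : ℤ))]
  rw [← Finset.smul_sum]
  simp only [← smul_mul_assoc]
  rw [← Finset.sum_mul]
  convert smul_zero _
  convert zero_mul _
  rw [← hdet]
  refine Finset.sum_congr rfl fun σ _ => ?_
  rw [Units.smul_def]
  congr 1
  refine Finset.prod_congr rfl ?_
  rintro (x | x) _ <;> rfl

theorem minor_shuffle_of_mapsTo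
    (hσ : Set.MapsTo σ (Set.range Sum.inl) (Set.range Sum.inl)) :
    (Equiv.Perm.sign σ : ℤ) • (minor (shuffleFst p q r s σ) * minor (shuffleSnd p q r s σ)) =
      minor r * minor s := by
  obtain ⟨⟨a, b⟩, rfl⟩ := Equiv.Perm.mem_sumCongrHom_range_of_perm_mapsTo_inl hσ
  have e1 : shuffleFst p q r s (Equiv.Perm.sumCongrHom _ _ (a, b)) =
      r ∘ Equiv.Perm.ofSubtype a := by
    ext i
    by_cases hi : p i
    · simp [shuffleFst, shuffleEntries, hi, Equiv.Perm.ofSubtype_apply_of_mem]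
    · simp [shuffleFst, hi, Equiv.Perm.ofSubtype_apply_of_not_mem]
  have e2 : shuffleSnd p q r s (Equiv.Perm.sumCongrHom _ _ (a, b)) =
      s ∘ Equiv.Perm.ofSubtype b := by
    ext i
    by_cases hi : q i
    · simp [shuffleSnd, shuffleEntries, hi, Equiv.Perm.ofSubtype_apply_of_mem]
    · simp [shuffleSnd, hi, Equiv.Perm.ofSubtype_apply_of_not_mem]
  rw [e1, e2, minor_comp_perm, minor_comp_perm, smul_mul_smul_comm, smul_smul]
  simp only [Equiv.Perm.sign_ofSubtype, Equiv.Perm.sumCongrHom_apply, Equiv.Perm.sign_sumCongr]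
  rw [← Units.val_mul, ← Units.val_mul, Int.units_mul_self]
  simp

/-- If all products arising from shuffles that move an entry of the first row into the second
lie in a subspace, then so does the original product. -/
theorem minor_mul_minor_mem (hhk : h ≤ k)
    (hcard : k < Fintype.card ({i // p i} ⊕ {j // q j}))
    (W : Submodule ℂ (MvPolynomial (ℕ × ℕ) ℂ))
    (hW : ∀ σ : Equiv.Perm ({i // p i} ⊕ {j // q j}),
      (∃ i j, σ (Sum.inl i) = Sum.inr j) →
      minor (shuffleFst p q r s σ) * minor (shuffleSnd p q r s σ) ∈ W) :
    minor r * minor s ∈ W := by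
  classical
  have hsum := shuffling_relation p q r s hhk hcard
  rw [← Finset.sum_filter_add_sum_filter_not _
    (fun σ : Equiv.Perm ({i // p i} ⊕ {j // q j}) =>
      Set.MapsTo σ (Set.range Sum.inl) (Set.range Sum.inl)),
    Finset.sum_congr rfl (fun σ hσ => minor_shuffle_of_mapsTo p q r s σ (Finset.mem_filter.1 hσ).2),
    Finset.sum_const] at hsum
  have hmem : _ ∈ W := (eq_neg_of_add_eq_zero_left hsum).symm ▸ neg_mem
    (Submodule.sum_mem W fun σ hσ => zsmul_mem (hW σ (by
      have hσ' := (Finset.mem_filter.1 hσ).2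
      simp only [Set.MapsTo, not_forall] at hσ'
      obtain ⟨_, ⟨i, rfl⟩, hi⟩ := hσ'
      cases hx : σ (Sum.inl i) with
      | inl y => exact absurd ⟨y, hx.symm⟩ hi
      | inr y => exact ⟨i, y, hx⟩)) (Equiv.Perm.sign σ : ℤ))
  rw [← Nat.cast_smul_eq_nsmul ℂ] at hmem
  refine (Submodule.smul_mem_iff W (Nat.cast_ne_zero.2 (Finset.card_pos.2 ⟨1, ?_⟩).ne')).1 hmem
  exact Finset.mem_filter.2 ⟨Finset.mem_univ _, Set.mapsTo_id _⟩

end Shuffle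

theorem exists_strictMono_minor {n : ℕ} {f : Fin n → ℕ} (hf : Function.Injective f) :
    ∃ τ : Equiv.Perm (Fin n), StrictMono (f ∘ τ) ∧
      minor f = (Equiv.Perm.sign τ : ℤ) • minor (f ∘ τ) := by
  refine ⟨Tuple.sort f, (Tuple.monotone_sort f).strictMono_of_injective
    (hf.comp (Equiv.injective _)), ?_⟩
  rw [minor_comp_perm, smul_smul, ← Units.val_mul, Int.units_mul_self]
  simp

theorem Monotone.apply_le_of_card {n : ℕ} {f : Fin n → ℕ} (hf : Monotone f) (a : Fin n)
    (c : ℕ) (hc : (a : ℕ) < (Finset.univ.filter fun i => f i ≤ c).card) : f a ≤ c := by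
  by_contra! hlt
  have hsub : (Finset.univ.filter fun i => f i ≤ c) ⊆ Finset.Iio a := by
    intro i hi
    rw [Finset.mem_Iio]
    by_contra! hai
    have := hf hai
    simp at hi
    omega
  have := Finset.card_le_card hsub
  simp at this
  omega

theorem Monotone.le_apply_of_card {n : ℕ} {f : Fin n → ℕ} (hf : Monotone f) (a : Fin n)
    (c : ℕ) (hc : (Finset.univ.filter fun i => f i < c).card ≤ a) : c ≤ f a := by
  by_contra! hlt
  have hsub : Finset.Iic a ⊆ Finset.univ.filter fun i => f i < c := by
    intro i hi
    have := hf (Finset.mem_Iic.1 hi)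
    simp
    omega
  have := Finset.card_le_card hsub
  simp at this
  omega

theorem card_filter_comp_perm {n : ℕ} (f : Fin n → ℕ) (τ : Equiv.Perm (Fin n)) (P : ℕ → Prop)
    [DecidablePred P] : (Finset.univ.filter fun i => P ((f ∘ τ) i)).card =
      (Finset.univ.filter fun i => P (f i)).card :=
  Finset.card_equiv τ (by simp)

section Violation

variable {k h t : ℕ} {r : Fin k → ℕ} {s : Fin h → ℕ}
  {σ : Equiv.Perm ({i : Fin k // t ≤ i} ⊕ {j : Fin h // (j : ℕ) ≤ t})}

theorem card_shuffleFst (hs : StrictMono s) (htk : t < k)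
    (hle : ∀ (i : Fin k) (j : Fin h), (i : ℕ) = j → (i : ℕ) < t → r i ≤ s j)
    (hσ : ∃ i j, σ (Sum.inl i) = Sum.inr j) (a : Fin h) (ha : (a : ℕ) ≤ t) :
    (a : ℕ) < (Finset.univ.filter fun i => shuffleFst _ _ r s σ i ≤ s a).card := by
  have hlow : ∀ i : Fin k, (i : ℕ) < t → i.val ≤ a → shuffleFst _ _ r s σ i ≤ s a := by
    intro i hi hia
    rw [shuffleFst, dif_neg (by omega)]
    exact (hle i ⟨i, by omega⟩ rfl hi).trans (hs.monotone hia)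
  rcases ha.lt_or_eq with hat | hat
  · have hsub : Finset.Iic (⟨a, by omega⟩ : Fin k) ⊆
        Finset.univ.filter fun i => shuffleFst _ _ r s σ i ≤ s a := by
      intro i hi
      have hi' : (i : ℕ) ≤ a := by simpa [Fin.le_def] using hi
      simpa using hlow i (by omega) hi'
    have := Finset.card_le_card hsub
    simp only [Fin.card_Iic] at this
    omega
  · obtain ⟨i₀, j₀, hij⟩ := hσ
    have hsub : insert i₀.1 (Finset.Iio (⟨t, htk⟩ : Fin k)) ⊆
        Finset.univ.filter fun i => shuffleFst _ _ r s σ i ≤ s a := by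
      intro i hi
      rcases Finset.mem_insert.1 hi with rfl | hi
      · simp only [Finset.mem_filter, Finset.mem_univ, true_and]
        rw [shuffleFst, dif_pos i₀.2, hij]
        exact hs.monotone (j₀.2.trans hat.ge)
      · have hi' : (i : ℕ) < t := by simpa [Fin.lt_def] using hi
        simpa using hlow i hi' (by omega)
    have := Finset.card_le_card hsub
    rw [Finset.card_insert_of_notMem, Fin.card_Iio] at this
    · simp only at this
      omega
    · simpa [Fin.lt_def] using i₀.2

theorem card_shuffleSnd (hr : StrictMono r) (hs : StrictMono s) (hth : t < h) (htk : t < k)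
    (hlt : s ⟨t, hth⟩ < r ⟨t, htk⟩) (hinj : Function.Injective (shuffleSnd _ _ r s σ))
    (a : Fin h) (ha : (a : ℕ) ≤ t) :
    (Finset.univ.filter fun j => shuffleSnd _ _ r s σ j < s a).card ≤ a := by
  have hat : s a ≤ s ⟨t, hth⟩ := hs.monotone ha
  rw [← Finset.card_image_of_injective _ hinj, ← Fin.card_Iio a,
    ← Finset.card_image_of_injective (Finset.Iio a) hs.injective]
  refine Finset.card_le_card fun x hx => ?_
  simp only [Finset.mem_image, Finset.mem_filter, Finset.mem_univ, true_and] at hx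
  obtain ⟨j, hj, rfl⟩ := hx
  suffices ∃ b, s b = shuffleSnd _ _ r s σ j by
    obtain ⟨b, hb⟩ := this
    rw [← hb] at hj ⊢
    exact Finset.mem_image_of_mem _ (Finset.mem_Iio.2 (hs.lt_iff_lt.1 hj))
  by_cases hjt : (j : ℕ) ≤ t
  · rw [shuffleSnd, dif_pos hjt] at hj ⊢
    cases hx : σ (Sum.inr ⟨j, hjt⟩) with
    | inl i =>
      rw [hx] at hj
      have : r ⟨t, htk⟩ ≤ r i := hr.monotone i.2
      simp only [shuffleEntries, Sum.elim_inl] at hj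
      omega
    | inr b => exact ⟨b, rfl⟩
  · exact ⟨j, by rw [shuffleSnd, dif_neg hjt]⟩

end Violation

theorem rowRel_or_exists_violIdx {R S : List ℕ} {t : ℕ} (hlen : S.length ≤ R.length)
    (hle : ∀ a < S.length, a ≤ t → R.getD a 0 ≤ S.getD a 0) :
    rowRel R S ∨ ∃ t', t < t' ∧ ViolIdx R S t' := by
  classical
  rw [rowRel, if_pos hlen, or_iff_not_imp_left]
  intro hex
  push Not at hex
  refine ⟨Nat.find hex, ?_, (Nat.find_spec hex).1, (Nat.find_spec hex).2, fun t' ht' => ?_⟩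
  · by_contra! hc
    exact (Nat.find_spec hex).2.not_ge (hle _ (Nat.find_spec hex).1 hc)
  · by_contra! hc
    exact Nat.find_min hex ht' ⟨ht'.trans (Nat.find_spec hex).1, hc⟩

theorem isRow_iff {ℓ : ℕ} {R : List ℕ} :
    IsRow ℓ R ↔ R.SortedLT ∧ ∀ x ∈ R, 1 ≤ x ∧ x ≤ ℓ + 1 :=
  and_congr_left' List.sortedLT_iff_isChain.symm

/-- One application of a shuffling relation to a pair of rows violating standardness. -/
theorem pluck_mul_pluck_mem_span_of_violIdx {ℓ t : ℕ} {R S : List ℕ}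
    (hR : IsRow ℓ R) (hS : IsRow ℓ S) (hSR : S.length ≤ R.length) (hviol : ViolIdx R S t) :
    pluck R * pluck S ∈ Submodule.span ℂ
      {x : MvPolynomial (ℕ × ℕ) ℂ | ∃ R' S',
        IsRow ℓ R' ∧ IsRow ℓ S' ∧ R'.length = R.length ∧ S'.length = S.length ∧
        (↑R' + ↑S' : Multiset ℕ) = ↑R + ↑S ∧
        (rowRel R' S' ∨ ∃ t', t < t' ∧ ViolIdx R' S' t') ∧
        x = pluck R' * pluck S'} := by
  obtain ⟨hth, hlt, hle⟩ := hviol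
  have htk : t < R.length := hth.trans_le hSR
  have hr : StrictMono R.get := (isRow_iff.1 hR).1.strictMono_get
  have hs : StrictMono S.get := (isRow_iff.1 hS).1.strictMono_get
  refine minor_mul_minor_mem (fun i : Fin R.length => t ≤ i) (fun j : Fin S.length => (j : ℕ) ≤ t)
    R.get S.get hSR ?_ _ fun σ hσ => ?_
  · rw [Fintype.card_sum, Fintype.card_subtype, Fintype.card_subtype]
    have h1 : (Finset.univ.filter fun i : Fin R.length => t ≤ i) = Finset.Ici ⟨t, htk⟩ := by
      ext; simp [Fin.le_def]
    have h2 : (Finset.univ.filter fun j : Fin S.length => (j : ℕ) ≤ t) = Finset.Iic ⟨t, hth⟩ := by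
      ext; simp [Fin.le_def]
    rw [h1, h2, Fin.card_Ici, Fin.card_Iic]
    simp only
    omega
  set f := shuffleFst _ _ R.get S.get σ
  set g := shuffleSnd _ _ R.get S.get σ
  by_cases hfi : Function.Injective f
  swap
  · simp [minor_eq_zero_of_not_injective hfi]
  by_cases hgi : Function.Injective g
  swap
  · simp [minor_eq_zero_of_not_injective hgi]
  obtain ⟨τ, hτ, hfτ⟩ := exists_strictMono_minor hfi
  obtain ⟨ρ, hρ, hgρ⟩ := exists_strictMono_minor hgi
  rw [hfτ, hgρ, smul_mul_smul_comm]
  refine zsmul_mem (Submodule.subset_span ?_) _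
  have hperm : ∀ {n : ℕ} (e : Fin n → ℕ) (π : Equiv.Perm (Fin n)),
      (↑(List.ofFn (e ∘ π)) : Multiset ℕ) = ↑(List.ofFn e) := by
    intro n e π
    exact Multiset.coe_eq_coe.2 (Equiv.Perm.ofFn_comp_perm π e)
  have hcont : (↑(List.ofFn (f ∘ τ)) + ↑(List.ofFn (g ∘ ρ)) : Multiset ℕ) = ↑R + ↑S := by
    rw [hperm, hperm, shuffle_content, List.ofFn_get, List.ofFn_get]
  have hbd : ∀ x ∈ (↑(List.ofFn (f ∘ τ)) + ↑(List.ofFn (g ∘ ρ)) : Multiset ℕ),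
      1 ≤ x ∧ x ≤ ℓ + 1 := by
    rw [hcont]
    intro x hx
    rcases Multiset.mem_add.1 hx with hx | hx
    exacts [hR.2 x hx, hS.2 x hx]
  refine ⟨List.ofFn (f ∘ τ), List.ofFn (g ∘ ρ),
    isRow_iff.2 ⟨hτ.sortedLT_ofFn, fun x hx => hbd x (Multiset.mem_add.2 (.inl hx))⟩,
    isRow_iff.2 ⟨hρ.sortedLT_ofFn, fun x hx => hbd x (Multiset.mem_add.2 (.inr hx))⟩,
    List.length_ofFn, List.length_ofFn, hcont,
    rowRel_or_exists_violIdx (by simpa using hSR) fun a ha hat => ?_, ?_⟩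
  · rw [List.length_ofFn] at ha
    have hak : a < R.length := ha.trans_le hSR
    rw [List.getD_eq_getElem _ _ (by simpa using hak), List.getD_eq_getElem _ _ (by simpa using ha),
      List.getElem_ofFn, List.getElem_ofFn]
    refine le_trans (b := S.get ⟨a, ha⟩)
      (Monotone.apply_le_of_card hτ.monotone ⟨a, hak⟩ _ ?_)
      (Monotone.le_apply_of_card hρ.monotone ⟨a, ha⟩ _ ?_)
    · rw [card_filter_comp_perm f τ (· ≤ S.get ⟨a, ha⟩)]
      refine card_shuffleFst hs htk (fun i j hij hit => ?_) hσ ⟨a, ha⟩ hat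
      have := hle i hit
      rw [List.getD_eq_getElem _ _ i.2, List.getD_eq_getElem _ _ (hij ▸ j.2)] at this
      simpa [hij] using this
    · rw [card_filter_comp_perm g ρ (· < S.get ⟨a, ha⟩)]
      refine card_shuffleSnd hr hs hth htk ?_ hgi ⟨a, ha⟩ hat
      rwa [List.getD_eq_getElem _ _ hth, List.getD_eq_getElem _ _ htk] at hlt
  · rw [pluck_ofFn, pluck_ofFn]

/-- The straightening relation obtained by iterating shuffling relations. -/
theorem pluck_mul_pluck_mem_span_rowRel {ℓ : ℕ} {R S : List ℕ} (t : ℕ)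
    (hR : IsRow ℓ R) (hS : IsRow ℓ S) (hSR : S.length ≤ R.length) (hviol : ViolIdx R S t) :
    pluck R * pluck S ∈ Submodule.span ℂ
      {x : MvPolynomial (ℕ × ℕ) ℂ | ∃ R' S',
        IsRow ℓ R' ∧ IsRow ℓ S' ∧ R'.length = R.length ∧ S'.length = S.length ∧
        (↑R' + ↑S' : Multiset ℕ) = ↑R + ↑S ∧
        rowRel R' S' ∧ x = pluck R' * pluck S'} := by
  refine Submodule.span_le.2 ?_ (pluck_mul_pluck_mem_span_of_violIdx hR hS hSR hviol)
  rintro _ ⟨R', S', hR', hS', hlR, hlS, hcont, hstd | ⟨t', htt', hviol'⟩, rfl⟩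
  · exact Submodule.subset_span ⟨R', S', hR', hS', hlR, hlS, hcont, hstd, rfl⟩
  · have ht' : t' < S.length := hlS ▸ hviol'.1
    have := pluck_mul_pluck_mem_span_rowRel t' hR' hS' (by omega) hviol'
    rwa [hlR, hlS, hcont] at this
termination_by S.length - t

/-- **(Termination of the shuffling algorithm.)**  Let `R, S` be rows of shapes
`k ≥ h` with index of violation `t`.  Each shuffling relation expresses
`[R][S]` as a linear combination of products `[R'][S']` with the same content,
each of which is either standard (i.e. `R' ⟵ S'`) or has index of violation
strictly greater than `t`; since the index of violation is bounded by the row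
length, finitely many applications of shuffling relations express `[R][S]` as a
linear combination of standard products, i.e. yield a straightening relation. -/
theorem shuffling_terminates (ℓ k h t : ℕ) (R S : List ℕ)
    (hR : IsRow ℓ R) (hS : IsRow ℓ S) (hk : R.length = k) (hh : S.length = h)
    (hkh : h ≤ k) (hviol : ViolIdx R S t) :
    -- one round of shuffling: standard terms or terms with larger violation index
    pluck R * pluck S ∈ Submodule.span ℂ
      {x : MvPolynomial (ℕ × ℕ) ℂ | ∃ R' S',
        IsRow ℓ R' ∧ IsRow ℓ S' ∧ R'.length = k ∧ S'.length = h ∧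
        (↑R' + ↑S' : Multiset ℕ) = ↑R + ↑S ∧
        (rowRel R' S' ∨ ∃ t', t < t' ∧ ViolIdx R' S' t') ∧
        x = pluck R' * pluck S'} ∧
    -- finitely many rounds terminate in a straightening relation
    pluck R * pluck S ∈ Submodule.span ℂ
      {x : MvPolynomial (ℕ × ℕ) ℂ | ∃ R' S',
        IsRow ℓ R' ∧ IsRow ℓ S' ∧ R'.length = k ∧ S'.length = h ∧
        (↑R' + ↑S' : Multiset ℕ) = ↑R + ↑S ∧
        rowRel R' S' ∧ x = pluck R' * pluck S'} := by
  subst hk hh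
  exact ⟨pluck_mul_pluck_mem_span_of_violIdx hR hS hkh hviol,
    pluck_mul_pluck_mem_span_rowRel t hR hS hkh hviol⟩
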